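/- For a natural number n ≥ 3 and a nonzero real number m, the system (n−1)b + c = −1, (n−1)b² − c² = −1/m has exactly one real solution pair (b, c) if and only if m = −(n−2), and in that case the unique solution is b = −1/(n−2) and c = 1/(n−2). -/

import Mathlib

/-- Eliminating `c` and completing the square in `b`, with `d = n - 2`. -/
lemma system_iff_sq_eq {d : ℝ} (hd : d ≠ 0) (m b c : ℝ) :
    ((d + 1) * b + c = -1 ∧ (d + 1) * b ^ 2 - c ^ 2 = -1 / m) ↔
      c = -1 - (d + 1) * b ∧ (d + 1) * d * (b + 1 / d) ^ 2 = 1 / m + 1 / d := by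
  have key : (d + 1) * d * (b + 1 / d) ^ 2 - (1 / m + 1 / d) =
      -((d + 1) * b ^ 2 - (-1 - (d + 1) * b) ^ 2 - -1 / m) := by
    rw [neg_div]
    generalize 1 / m = t
    field_simp
    ring
  constructor
  · rintro ⟨h₁, h₂⟩
    obtain rfl : c = -1 - (d + 1) * b := by linarith
    exact ⟨rfl, by linarith⟩
  · rintro ⟨rfl, h⟩
    exact ⟨by ring, by linarith⟩


/-- For `n ≥ 3` and `m ≠ 0`, the system `(n−1)b + c = −1`, `(n−1)b² − c² = −1/m` has
exactly one real solution pair `(b, c)` iff `m = −(n−2)`, in which case the unique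
solution is `b = −1/(n−2)`, `c = 1/(n−2)`. -/
theorem system_unique_iff (n : ℕ) (hn : 3 ≤ n) (m : ℝ) (hm : m ≠ 0) :
    ((∃! p : ℝ × ℝ,
        ((n : ℝ) - 1) * p.1 + p.2 = -1 ∧ ((n : ℝ) - 1) * p.1 ^ 2 - p.2 ^ 2 = -1 / m) ↔
      m = -((n : ℝ) - 2)) ∧
    (m = -((n : ℝ) - 2) →
      ∀ b c : ℝ,
        (((n : ℝ) - 1) * b + c = -1 ∧ ((n : ℝ) - 1) * b ^ 2 - c ^ 2 = -1 / m) ↔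
        (b = -1 / ((n : ℝ) - 2) ∧ c = 1 / ((n : ℝ) - 2))) := by
  obtain ⟨d, hd⟩ : ∃ d : ℝ, d = (n : ℝ) - 2 := ⟨_, rfl⟩
  have hd_pos : 0 < d := by
    have : (3 : ℝ) ≤ n := by exact_mod_cast hn
    linarith
  have hd_succ : (n : ℝ) - 1 = d + 1 := by linarith
  simp only [hd_succ, ← hd, system_iff_sq_eq hd_pos.ne']
  have solve : m = -d → ∀ b c : ℝ,
      (c = -1 - (d + 1) * b ∧ (d + 1) * d * (b + 1 / d) ^ 2 = 1 / m + 1 / d) ↔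
        (b = -1 / d ∧ c = 1 / d) := by
    rintro rfl b c
    have hzero : 1 / -d + 1 / d = 0 := by rw [div_neg, neg_add_cancel]
    have hcoeff : (d + 1) * d ≠ 0 := by positivity
    rw [hzero, mul_eq_zero_iff_left hcoeff, sq_eq_zero_iff, add_eq_zero_iff_eq_neg, ← neg_div,
      and_comm]
    refine and_congr_right ?_
    rintro rfl
    have : -1 - (d + 1) * (-1 / d) = 1 / d := by field_simp; ring
    rw [this]
  refine ⟨⟨?_, fun h => ?_⟩, solve⟩
  · rintro ⟨⟨b, c⟩, ⟨-, hb⟩, huniq⟩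
    have hreflect := huniq (-2 / d - b, -1 - (d + 1) * (-2 / d - b))
      ⟨rfl, by rw [← hb]; ring⟩
    have hself := congrArg Prod.fst hreflect
    have hb_zero : b + 1 / d = 0 := by
      dsimp only at hself
      linear_combination (-1 / 2) * hself
    dsimp only at hb
    rw [hb_zero] at hb
    field_simp at hb
    linarith
  · refine ⟨(-1 / d, 1 / d), (solve h _ _).2 ⟨rfl, rfl⟩, ?_⟩
    rintro ⟨b, c⟩ hbc
    exact Prod.ext_iff.2 ((solve h b c).1 hbc)
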